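/- arXiv:1502.06318 — 6 statements merged into one kernel-verified Lean document; each statement's English description precedes it below -/
import Mathlib

section
/- Every college admissions market with strict complete preference lists admits at least one stable matching. -/
/-- A college admissions market: capacities `q` (each at least 1) and, for every
student and every college, a strict complete preference list, modelled as a
`LinearOrder` in which *greater* means *more preferred*. -/
structure Market (S C : Type*) [Fintype S] [Fintype C] where
  q : C → ℕ
  q_pos : ∀ c, 1 ≤ q c
  sPref : S → LinearOrder C
  cPref : C → LinearOrder S

variable {S C : Type*} [Fintype S] [Fintype C]

/-- Student `s` strictly prefers college `c` to college `c'`. -/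
def Market.sprefers (M : Market S C) (s : S) (c c' : C) : Prop :=
  (M.sPref s).lt c' c

/-- College `c` strictly prefers student `s` to student `s'`. -/
def Market.cprefers (M : Market S C) (c : C) (s s' : S) : Prop :=
  (M.cPref c).lt s' s

/-- A matching: each college gets a set of students within its capacity, and the
sets of distinct colleges are disjoint (so each student has at most one college). -/
structure Matching (M : Market S C) where
  assign : C → Finset S
  card_le : ∀ c, (assign c).card ≤ M.q c
  disjoint : ∀ c c', c ≠ c' → Disjoint (assign c) (assign c')

/-- `(s, c)` is a blocking pair: `s` is unmatched or prefers `c` to his current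
college, and `c` has a free slot or prefers `s` to one of its current students. -/
def Blocks (M : Market S C) (μ : Matching M) (s : S) (c : C) : Prop :=
  (∀ c', s ∈ μ.assign c' → M.sprefers s c c') ∧
  ((μ.assign c).card < M.q c ∨ ∃ s' ∈ μ.assign c, M.cprefers c s s')

/-- A matching is stable if it admits no blocking pair. -/
def Stable (M : Market S C) (μ : Matching M) : Prop :=
  ∀ s c, ¬ Blocks M μ s c

/-- Student `s` weakly prefers his assignment under `μ` to his assignment under `ν`:
either the assignments coincide, or `s` is matched under `μ` to a college that he
strictly prefers to his situation under `ν` (being matched beats being unmatched). -/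
def SWeakPref (M : Market S C) (μ ν : Matching M) (s : S) : Prop :=
  (∀ c, s ∈ μ.assign c ↔ s ∈ ν.assign c) ∨
  ∃ c, s ∈ μ.assign c ∧
    ((∀ c', s ∉ ν.assign c') ∨ ∃ c', s ∈ ν.assign c' ∧ M.sprefers s c c')

/-- The student-optimal stable matching. -/
def StudentOptimal (M : Market S C) (μ : Matching M) : Prop :=
  Stable M μ ∧ ∀ ν : Matching M, Stable M ν → ∀ s, SWeakPref M μ ν s

/-- `X` (weakly) responsively dominates `Y` w.r.t. college `c`'s preferences:
there is an injection `g : Y → X` with `g s = s` or `g s >_c s` for all `s ∈ Y`. -/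
def RespDominates (M : Market S C) (c : C) (X Y : Finset S) : Prop :=
  ∃ g : S → S, Set.InjOn g ↑Y ∧ (∀ s ∈ Y, g s ∈ X) ∧
    ∀ s ∈ Y, g s = s ∨ M.cprefers c (g s) s

/-- Strict responsive domination. -/
def StrictRespDominates (M : Market S C) (c : C) (X Y : Finset S) : Prop :=
  X ≠ Y ∧ RespDominates M c X Y

/-- The college-optimal stable matching. -/
def CollegeOptimal (M : Market S C) (μ : Matching M) : Prop :=
  Stable M μ ∧ ∀ ν : Matching M, Stable M ν → ∀ c, RespDominates M c (μ.assign c) (ν.assign c)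

/-- The market in which college `c` reports the list `P` instead of its true list,
while everything else is unchanged. -/
def replaceCPref [DecidableEq C] (M : Market S C) (c : C) (P : LinearOrder S) :
    Market S C :=
  { M with cPref := Function.update M.cPref c P }

/-- The market in which student `s` reports the list `P` instead of his true list,
while everything else is unchanged. -/
def replaceSPref [DecidableEq S] (M : Market S C) (s : S) (P : LinearOrder C) :
    Market S C :=
  { M with sPref := Function.update M.sPref s P }

/-- Preferences of a student over the copies of the colleges in the associated
one-to-one market: copies of colleges are compared according to the student's order
over colleges, and within a block of copies smaller index is better. -/
def assocSPref (M : Market S C) (s : S) : LinearOrder ((c : C) × Fin (M.q c)) :=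
  letI := M.sPref s
  LinearOrder.lift' (fun x => toLex ((x.1 : C), (M.q x.1 - (x.2 : ℕ)))) (by
    rintro ⟨c, i⟩ ⟨c', j⟩ h
    have h' : ((c : C), M.q c - (i : ℕ)) = (c', M.q c' - (j : ℕ)) := toLex.injective h
    have h1 : c = c' := congrArg Prod.fst h'
    subst h1
    have h2 : M.q c - (i : ℕ) = M.q c - (j : ℕ) := congrArg Prod.snd h'
    have hi := i.isLt
    have hj := j.isLt
    have : (i : ℕ) = (j : ℕ) := by omega
    exact congrArg (Sigma.mk c) (Fin.ext this))

/-- The associated one-to-one market: college `c` is replaced by `q c` copies,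
each of capacity one and with `c`'s preferences over students; students' preferences
over copies are induced blockwise from their preferences over colleges. -/
def assocMarket (M : Market S C) : Market S ((c : C) × Fin (M.q c)) :=
  { q := fun _ => 1
    q_pos := fun _ => le_refl 1
    sPref := assocSPref M
    cPref := fun x => M.cPref x.1 }

open Classical in
/-- The students who apply to `c` when each student applies to his favourite college
among those that have not rejected him, `R` being the set of rejections so far. -/
noncomputable def Market.applicants (M : Market S C) (R : Finset (S × C)) (c : C) : Finset S :=
  {s | (s, c) ∉ R ∧ ∀ c', (s, c') ∉ R → (M.sPref s).le c' c}

open Classical in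
/-- A set of rejections is justified if every rejected student is outranked, at the college
that rejected him, by enough current applicants to fill that college. -/
def Market.Justified (M : Market S C) (R : Finset (S × C)) : Prop :=
  ∀ s c, (s, c) ∈ R → M.q c ≤ ((M.applicants R c).filter fun s' => M.cprefers c s' s).card

theorem Market.mem_applicants (M : Market S C) {R : Finset (S × C)} {s : S} {c : C} :
    s ∈ M.applicants R c ↔ (s, c) ∉ R ∧ ∀ c', (s, c') ∉ R → (M.sPref s).le c' c := by
  simp [Market.applicants]

theorem Market.eq_of_mem_applicants (M : Market S C) {R : Finset (S × C)} {s : S} {c c' : C}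
    (h : s ∈ M.applicants R c) (h' : s ∈ M.applicants R c') : c = c' := by
  rw [M.mem_applicants] at h h'
  exact (M.sPref s).le_antisymm _ _ (h'.2 _ h.1) (h.2 _ h'.1)

/-- A student who has not been rejected by `c` applies to a college he likes at least as much. -/
theorem Market.exists_mem_applicants (M : Market S C) {R : Finset (S × C)} {s : S} {c : C}
    (h : (s, c) ∉ R) : ∃ c', s ∈ M.applicants R c' ∧ (M.sPref s).le c c' := by
  classical
  let := M.sPref s
  obtain ⟨c', hc', hmax⟩ := ({c | (s, c) ∉ R} : Finset C).exists_max_image id ⟨c, by simpa using h⟩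
  refine ⟨c', M.mem_applicants.2 ⟨by simpa using hc', fun d hd => ?_⟩, ?_⟩
  · exact hmax d (by simpa using hd)
  · exact hmax c (by simpa using h)

open Classical in
/-- If student `s` is rejected by the college he applies to, all other applications stand. -/
theorem Market.mem_applicants_insert (M : Market S C) {R : Finset (S × C)} {s t : S} {c d : C}
    (hs : s ∈ M.applicants R c) (ht : t ∈ M.applicants R d) (hne : t ≠ s ∨ d ≠ c) :
    t ∈ M.applicants (insert (s, c) R) d := by
  have hts : t ≠ s := by
    rintro rfl
    exact hne.elim (fun h => h rfl) fun h => h (M.eq_of_mem_applicants ht hs)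
  simpa [M.mem_applicants, hts] using ht

open Classical in
/-- An overdemanded college may reject its least preferred applicant. -/
theorem Market.Justified.insert {M : Market S C} {R : Finset (S × C)} (hR : M.Justified R)
    {s : S} {c : C} (hs : s ∈ M.applicants R c)
    (hmin : ∀ t ∈ M.applicants R c, (M.cPref c).le s t)
    (hq : M.q c < (M.applicants R c).card) : M.Justified (insert (s, c) R) := by
  have hlt : ∀ t ∈ (M.applicants R c).erase s, M.cprefers c t s := by
    intro t ht
    rw [Finset.mem_erase] at ht
    let := M.cPref c
    exact lt_of_le_of_ne (hmin t ht.2) ht.1.symm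
  have hcard : M.q c ≤ ((M.applicants R c).erase s).card := by
    rw [Finset.card_erase_of_mem hs]; omega
  have hmem : ∀ t ∈ (M.applicants R c).erase s, t ∈ M.applicants (Insert.insert (s, c) R) c := by
    intro t ht
    rw [Finset.mem_erase] at ht
    exact M.mem_applicants_insert hs ht.2 (.inl ht.1)
  have hfill : ∀ t, (t = s ∨ M.cprefers c s t) →
      M.q c ≤ ((M.applicants (Insert.insert (s, c) R) c).filter
        fun s' => M.cprefers c s' t).card := by
    intro t hst
    refine hcard.trans (Finset.card_le_card fun u hu => Finset.mem_filter.2 ⟨hmem u hu, ?_⟩)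
    rcases hst with rfl | hst
    · exact hlt u hu
    · let := M.cPref c
      exact lt_trans (α := S) hst (hlt u hu)
  intro t d htd
  rw [Finset.mem_insert, Prod.mk.injEq] at htd
  rcases htd with ⟨rfl, rfl⟩ | htd
  · exact hfill t (.inl rfl)
  by_cases h : d = c ∧ M.cprefers c s t
  · obtain ⟨rfl, h⟩ := h
    exact hfill t (.inr h)
  · refine (hR t d htd).trans (Finset.card_le_card fun u hu => ?_)
    rw [Finset.mem_filter] at hu ⊢
    refine ⟨M.mem_applicants_insert hs hu.1 ?_, hu.2⟩
    by_contra! hne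
    obtain ⟨rfl, rfl⟩ := hne
    exact h ⟨rfl, hu.2⟩

/-- Some justified set of rejections leaves no college overdemanded. -/
theorem Market.exists_justified_card_applicants_le (M : Market S C) :
    ∃ R : Finset (S × C), M.Justified R ∧ ∀ c, (M.applicants R c).card ≤ M.q c := by
  classical
  obtain ⟨R, hR, hmax⟩ := ({R | M.Justified R} : Finset (Finset (S × C))).exists_max_image
    Finset.card ⟨∅, Finset.mem_filter_univ _ |>.2 (by simp [Market.Justified])⟩
  replace hR : M.Justified R := by simpa using hR
  refine ⟨R, hR, fun c => ?_⟩
  by_contra! hq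
  obtain ⟨s, hs, hmin⟩ := @Finset.exists_min_image _ _ (M.cPref c) (M.applicants R c) id
    (Finset.card_pos.1 (Nat.zero_lt_of_lt hq))
  have hle := hmax (insert (s, c) R) (by simpa using hR.insert hs hmin hq)
  rw [Finset.card_insert_of_notMem (M.mem_applicants.1 hs).1] at hle
  omega

/-- Every college admissions market with strict complete preference
lists admits at least one stable matching. -/
theorem stmt_0 {S C : Type*} [Fintype S] [Fintype C] (M : Market S C) :
    ∃ μ : Matching M, Stable M μ := by
  classical
  obtain ⟨R, hR, hcard⟩ := M.exists_justified_card_applicants_le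
  refine ⟨⟨M.applicants R, hcard, fun c c' hne => Finset.disjoint_left.2 fun s h h' =>
    hne (M.eq_of_mem_applicants h h')⟩, ?_⟩
  rintro s c ⟨hs, hc⟩
  have hrej : (s, c) ∈ R := by
    by_contra h
    obtain ⟨c', hc', hle⟩ := M.exists_mem_applicants h
    let := M.sPref s
    exact not_lt_of_ge (α := C) hle (hs c' hc')
  have hfull := hR s c hrej
  have heq := Finset.eq_of_subset_of_card_le (Finset.filter_subset _ _) ((hcard c).trans hfull)
  rcases hc with hc | ⟨t, ht, hst⟩
  · exact absurd (hfull.trans (Finset.card_filter_le _ _)) (not_le_of_gt hc)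
  · let := M.cPref c
    change t ∈ M.applicants R c at ht
    rw [← heq, Finset.mem_filter] at ht
    exact lt_asymm (α := S) hst ht.2
end

section
/- In every college admissions market with strict complete preference lists there exists a unique stable matching μ_S such that for every stable matching μ and every student s, either s's assignment under μ_S equals his assignment under μ, or s strictly prefers his assignment under μ_S to his assignment under μ (where being matched to any college is preferred to being unmatched). -/
variable {S C : Type*} [Fintype S] [Fintype C]

namespace Market

/-- The students whose favourite college, among those that have not rejected them, is `c`;
`R` is the set of rejections made so far. -/
noncomputable def applicants_s1 (M : Market S C) (R : Finset (S × C)) (c : C) : Finset S :=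
  open Classical in
  Finset.univ.filter fun s => (s, c) ∉ R ∧ ∀ c', M.sprefers s c' c → (s, c') ∈ R

/-- A set of rejections is justified if it rejects no pair that is matched in some stable
matching, and each rejecting college has enough better applicants to fill its capacity. -/
def Justified_s1 (M : Market S C) (R : Finset (S × C)) : Prop :=
  (∀ μ : Matching M, Stable M μ → ∀ s c, (s, c) ∈ R → s ∉ μ.assign c) ∧
  ∀ s c, (s, c) ∈ R →
    ∃ T ⊆ M.applicants_s1 R c, M.q c ≤ T.card ∧ ∀ t ∈ T, M.cprefers c t s

variable {M : Market S C} {R : Finset (S × C)}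

theorem mem_applicants_s1 {c : C} {s : S} :
    s ∈ M.applicants_s1 R c ↔ (s, c) ∉ R ∧ ∀ c', M.sprefers s c' c → (s, c') ∈ R := by
  simp [applicants_s1]

theorem sprefers_trichotomy (M : Market S C) (s : S) (c c' : C) :
    M.sprefers s c c' ∨ c = c' ∨ M.sprefers s c' c := by
  let := M.sPref s
  rcases lt_trichotomy c' c with h | h | h
  exacts [.inl h, .inr (.inl h.symm), .inr (.inr h)]

theorem sprefers_irrefl (M : Market S C) (s : S) (c : C) : ¬ M.sprefers s c c :=
  let := M.sPref s
  lt_irrefl c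

theorem sprefers_asymm {s : S} {c c' : C} (h : M.sprefers s c c') :
    ¬ M.sprefers s c' c :=
  let := M.sPref s
  lt_asymm (show c' < c from h)

theorem cprefers_asymm {c : C} {s s' : S} (h : M.cprefers c s s') :
    ¬ M.cprefers c s' s :=
  let := M.cPref c
  lt_asymm (show s' < s from h)

theorem cprefers_trans {c : C} {s t u : S} (h : M.cprefers c s t) (h' : M.cprefers c t u) :
    M.cprefers c s u :=
  let := M.cPref c
  lt_trans (show u < t from h') (show t < s from h)

theorem exists_worst (M : Market S C) (c : C) {A : Finset S} (hA : A.Nonempty) :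
    ∃ s ∈ A, ∀ t ∈ A, t ≠ s → M.cprefers c t s := by
  let := M.cPref c
  obtain ⟨s, hs, hmin⟩ := A.exists_min_image id hA
  exact ⟨s, hs, fun t ht hne => lt_of_le_of_ne (hmin t ht) hne.symm⟩

theorem eq_of_mem_applicants_s1 {s : S} {c c' : C} (h : s ∈ M.applicants_s1 R c)
    (h' : s ∈ M.applicants_s1 R c') : c = c' := by
  rw [mem_applicants_s1] at h h'
  rcases M.sprefers_trichotomy s c c' with hlt | heq | hlt
  · exact absurd (h'.2 c hlt) h.1
  · exact heq
  · exact absurd (h.2 c' hlt) h'.1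

/-- A student whom `c` has not rejected applies to `c` or to a college preferred to `c`. -/
theorem exists_mem_applicants_s1 {s : S} {c : C} (h : (s, c) ∉ R) :
    ∃ d, s ∈ M.applicants_s1 R d ∧ (d = c ∨ M.sprefers s d c) := by
  classical
  let := M.sPref s
  obtain ⟨d, hd, hmax⟩ := (Finset.univ.filter fun d => (s, d) ∉ R).exists_max_image id
    ⟨c, by simpa using h⟩
  simp only [Finset.mem_filter, Finset.mem_univ, true_and, id] at hd hmax
  refine ⟨d, mem_applicants_s1.2 ⟨hd, fun c' hc' => ?_⟩, ?_⟩
  · by_contra hn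
    exact (hmax c' hn).not_gt hc'
  · rcases (hmax c h).eq_or_lt with heq | hlt
    exacts [.inl heq.symm, .inr hlt]

theorem justified_empty (M : Market S C) : M.Justified_s1 ∅ := by
  simp [Justified_s1]

theorem applicants_erase_subset [DecidableEq S] [DecidableEq C] (s : S) (c d : C) :
    (M.applicants_s1 R d).erase s ⊆ M.applicants_s1 (insert (s, c) R) d := by
  intro t ht
  rw [Finset.mem_erase, mem_applicants_s1] at ht
  rw [mem_applicants_s1]
  refine ⟨fun h => ?_, fun c' hc' => Finset.mem_insert_of_mem (ht.2.2 c' hc')⟩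
  rcases Finset.mem_insert.1 h with h | h
  · exact ht.1 (congrArg Prod.fst h)
  · exact ht.2.1 h

/-- An oversubscribed college may reject its worst applicant. -/
theorem Justified_s1.insert_worst [DecidableEq S] [DecidableEq C] (hR : M.Justified_s1 R) {s : S}
    {c : C} (hcard : M.q c < (M.applicants_s1 R c).card) (hs : s ∈ M.applicants_s1 R c)
    (hworst : ∀ t ∈ M.applicants_s1 R c, t ≠ s → M.cprefers c t s) :
    M.Justified_s1 (insert (s, c) R) := by
  have hq : M.q c ≤ ((M.applicants_s1 R c).erase s).card := by
    rw [Finset.card_erase_of_mem hs]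
    omega
  have hbetter : ∀ t ∈ (M.applicants_s1 R c).erase s, M.cprefers c t s := fun t ht =>
    hworst t (Finset.mem_of_mem_erase ht) (Finset.ne_of_mem_erase ht)
  constructor
  · intro μ hμ t d htd
    rcases Finset.mem_insert.1 htd with h | h
    · obtain ⟨rfl, rfl⟩ := Prod.mk.inj h
      intro hmem
      obtain ⟨u, hu, hun⟩ : ∃ u ∈ (M.applicants_s1 R d).erase t, u ∉ μ.assign d := by
        by_contra! hsub
        have hle := Finset.card_le_card (Finset.insert_subset hmem hsub)
        rw [Finset.card_insert_of_notMem (Finset.notMem_erase _ _)] at hle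
        have := μ.card_le d
        omega
      refine hμ u d ⟨fun c' hc' => ?_, .inr ⟨t, hmem, hbetter u hu⟩⟩
      rcases M.sprefers_trichotomy u d c' with hlt | rfl | hlt
      · exact hlt
      · exact absurd hc' hun
      · exact absurd hc' (hR.1 μ hμ u c' ((mem_applicants_s1.1 (Finset.mem_of_mem_erase hu)).2 _ hlt))
    · exact hR.1 μ hμ t d h
  · intro t d htd
    rcases Finset.mem_insert.1 htd with h | h
    · obtain ⟨rfl, rfl⟩ := Prod.mk.inj h
      exact ⟨_, applicants_erase_subset t d d, hq, hbetter⟩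
    · obtain ⟨T, hT, hTq, hTt⟩ := hR.2 t d h
      by_cases hsT : s ∈ T
      · obtain rfl := eq_of_mem_applicants_s1 hs (hT hsT)
        exact ⟨_, applicants_erase_subset s c c, hq,
          fun u hu => cprefers_trans (hbetter u hu) (hTt s hsT)⟩
      · refine ⟨T, fun u hu => applicants_erase_subset s c d (Finset.mem_erase.2 ⟨?_, hT hu⟩),
          hTq, hTt⟩
        rintro rfl
        exact hsT hu

/-- Some justified set of rejections leaves no college oversubscribed. -/
theorem exists_justified_card_applicants_le_s1 (M : Market S C) :
    ∃ R, M.Justified_s1 R ∧ ∀ c, (M.applicants_s1 R c).card ≤ M.q c := by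
  classical
  obtain ⟨R, hR, hmax⟩ := (Finset.univ.filter M.Justified_s1).exists_max_image Finset.card
    ⟨∅, by simpa using M.justified_empty⟩
  simp only [Finset.mem_filter, Finset.mem_univ, true_and] at hR hmax
  refine ⟨R, hR, fun c => ?_⟩
  by_contra! hcard
  obtain ⟨s, hs, hworst⟩ := M.exists_worst c (Finset.card_pos.1 (Nat.zero_lt_of_lt hcard))
  have hle := hmax _ (hR.insert_worst hcard hs hworst)
  rw [Finset.card_insert_of_notMem (mem_applicants_s1.1 hs).1] at hle
  omega

/-- Every college admits all of its applicants. -/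
noncomputable def matchingOfApplicants (M : Market S C) (R : Finset (S × C))
    (hcard : ∀ c, (M.applicants_s1 R c).card ≤ M.q c) : Matching M where
  assign := M.applicants_s1 R
  card_le := hcard
  disjoint _ _ hne := Finset.disjoint_left.2 fun _ h h' => hne (eq_of_mem_applicants_s1 h h')

theorem Justified_s1.studentOptimal (hR : M.Justified_s1 R)
    (hcard : ∀ c, (M.applicants_s1 R c).card ≤ M.q c) :
    StudentOptimal M (M.matchingOfApplicants R hcard) := by
  constructor
  · rintro s c ⟨hs, hc⟩
    simp only [matchingOfApplicants] at hs hc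
    have hmem : (s, c) ∈ R := by
      by_contra hn
      obtain ⟨d, hd, rfl | hlt⟩ := exists_mem_applicants_s1 (M := M) hn
      · exact M.sprefers_irrefl s d (hs d hd)
      · exact sprefers_asymm hlt (hs d hd)
    obtain ⟨T, hT, hTq, hTs⟩ := hR.2 s c hmem
    obtain rfl := Finset.eq_of_subset_of_card_le hT ((hcard c).trans hTq)
    rcases hc with hlt | ⟨t, ht, hst⟩
    · omega
    · exact cprefers_asymm hst (hTs t ht)
  · intro ν hν s
    by_cases hs : ∃ c', s ∈ ν.assign c'
    · obtain ⟨c', hc'⟩ := hs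
      obtain ⟨d, hd, rfl | hlt⟩ :=
        exists_mem_applicants_s1 (M := M) fun h => hR.1 ν hν s c' h hc'
      · refine .inl fun c => ⟨fun h => ?_, fun h => ?_⟩
        · exact eq_of_mem_applicants_s1 hd h ▸ hc'
        · by_cases hne : d = c
          · exact hne ▸ hd
          · exact absurd h (Finset.disjoint_left.1 (ν.disjoint d c hne) hc')
      · exact .inr ⟨d, hd, .inr ⟨c', hc', hlt⟩⟩
    · push Not at hs
      by_cases hm : ∃ c, s ∈ M.applicants_s1 R c
      · obtain ⟨c, hc⟩ := hm
        exact .inr ⟨c, hc, .inl hs⟩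
      · push Not at hm
        exact .inl fun c => iff_of_false (hm c) (hs c)

end Market

theorem Matching.eq_of_mem {M : Market S C} (μ : Matching M) {s : S} {c c' : C}
    (h : s ∈ μ.assign c) (h' : s ∈ μ.assign c') : c = c' := by
  by_contra hne
  exact Finset.disjoint_left.1 (μ.disjoint c c' hne) h h'

theorem SWeakPref.antisymm {M : Market S C} {μ ν : Matching M} {s : S}
    (h : SWeakPref M μ ν s) (h' : SWeakPref M ν μ s) (c : C) :
    s ∈ μ.assign c ↔ s ∈ ν.assign c := by
  rcases h with h | ⟨d, hd, hν⟩
  · exact h c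
  rcases h' with h' | ⟨e, he, hμ⟩
  · exact (h' c).symm
  rcases hν with hν | ⟨e', he', hlt⟩
  · exact absurd he (hν e)
  rcases hμ with hμ | ⟨d', hd', hlt'⟩
  · exact absurd hd (hμ d)
  obtain rfl := μ.eq_of_mem hd hd'
  obtain rfl := ν.eq_of_mem he he'
  exact absurd hlt' (Market.sprefers_asymm hlt)

theorem StudentOptimal.unique {M : Market S C} {μ ν : Matching M}
    (hμ : StudentOptimal M μ) (hν : StudentOptimal M ν) : μ = ν := by
  have h : μ.assign = ν.assign := by
    ext c s
    exact (hμ.2 ν hν.1 s).antisymm (hν.2 μ hμ.1 s) c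
  cases μ
  cases ν
  congr

/-- Existence of a unique student-optimal stable matching: a stable
matching `μS` such that for every stable matching `μ` and every student `s`, either
`s`'s assignment under `μS` equals that under `μ`, or `s` strictly prefers his
assignment under `μS` (being matched beats being unmatched). -/
theorem stmt_1 {S C : Type*} [Fintype S] [Fintype C] (M : Market S C) :
    ∃! μS : Matching M, Stable M μS ∧
      ∀ μ : Matching M, Stable M μ → ∀ s : S,
        (∀ c, s ∈ μS.assign c ↔ s ∈ μ.assign c) ∨
        ∃ c, s ∈ μS.assign c ∧
          ((∀ c', s ∉ μ.assign c') ∨ ∃ c', s ∈ μ.assign c' ∧ M.sprefers s c c') := by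
  obtain ⟨R, hR, hcard⟩ := M.exists_justified_card_applicants_le_s1
  exact ⟨_, hR.studentOptimal hcard, fun _ hν => StudentOptimal.unique hν (hR.studentOptimal hcard)⟩
end

section
/- If a college c can beneficially manipulate the student-optimal stable mechanism via misrepresenting its preferences while all other agents report truthfully, then the truthful outcome μ satisfies |μ(c)| = q(c), i.e. c fills its capacity under the truthful student-optimal stable matching. -/
variable {S C : Type*} [Fintype S] [Fintype C]

/-- Viewing a matching of a market as a matching of the market with one college's list replaced. -/
def Matching.toReplaceCPref [DecidableEq C] {M : Market S C} (μ : Matching M) (c : C)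
    (P : LinearOrder S) : Matching (replaceCPref M c P) :=
  ⟨μ.assign, μ.card_le, μ.disjoint⟩

/-- A stable matching stays stable when a college with a free slot changes its list. -/
theorem Stable.toReplaceCPref [DecidableEq C] {M : Market S C} {μ : Matching M}
    (hμ : Stable M μ) {c : C} (hc : (μ.assign c).card < M.q c) (P : LinearOrder S) :
    Stable (replaceCPref M c P) (μ.toReplaceCPref c P) := by
  rintro s d ⟨hs, hd⟩
  refine hμ s d ⟨hs, ?_⟩
  by_cases hdc : d = c
  · exact Or.inl (hdc ▸ hc)
  · refine hd.imp_right ?_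
    rintro ⟨s', hs', h⟩
    have hpref : (replaceCPref M c P).cPref d = M.cPref d := by
      rw [replaceCPref]
      exact Function.update_of_ne hdc P M.cPref
    refine ⟨s', hs', ?_⟩
    rwa [Market.cprefers, hpref] at h

/-- If all students weakly prefer `ν` to a stable matching `μ`, then a college with a free slot
under `μ` gains no student under `ν`. -/
theorem Stable.assign_subset_of_sWeakPref {M : Market S C} {μ ν : Matching M}
    (hμ : Stable M μ) (hν : ∀ s, SWeakPref M ν μ s) {c : C}
    (hc : (μ.assign c).card < M.q c) : ν.assign c ⊆ μ.assign c := by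
  intro s hs
  rcases hν s with h | ⟨d, hd, h⟩
  · exact (h c).1 hs
  · have unique : ∀ {κ : Matching M} {a b : C}, s ∈ κ.assign a → s ∈ κ.assign b → a = b := by
      intro κ a b ha hb
      by_contra hab
      exact Finset.disjoint_left.1 (κ.disjoint a b hab) ha hb
    obtain rfl := unique hd hs
    refine absurd ⟨fun c' hc' => ?_, Or.inl hc⟩ (hμ s d)
    rcases h with h | ⟨e, he, h⟩
    · exact absurd hc' (h c')
    · exact unique hc' he ▸ h

/-- If a college `c` can beneficially manipulate the student-optimal
stable mechanism by misreporting (all other agents truthful), then `c` fills its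
capacity under the truthful student-optimal stable matching `μ`. -/
theorem stmt_3 {S C : Type*} [Fintype S] [Fintype C] [DecidableEq C]
    (M : Market S C) (c : C) (P : LinearOrder S)
    (μ : Matching M) (μ' : Matching (replaceCPref M c P))
    (hμ : StudentOptimal M μ) (hμ' : StudentOptimal (replaceCPref M c P) μ')
    (hben : StrictRespDominates M c (μ'.assign c) (μ.assign c)) :
    (μ.assign c).card = M.q c := by
  obtain ⟨hne, g, hinj, hmaps, -⟩ := hben
  by_contra hcard
  have hc : (μ.assign c).card < M.q c := lt_of_le_of_ne (μ.card_le c) hcard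
  have hstable := hμ.1.toReplaceCPref hc P
  have hsub : μ'.assign c ⊆ μ.assign c :=
    hstable.assign_subset_of_sWeakPref (hμ'.2 _ hstable) hc
  exact hne (Finset.eq_of_subset_of_card_le hsub (Finset.card_le_card_of_injOn g hmaps hinj))
end

section
/- If a college c can beneficially manipulate the college-optimal stable mechanism via misrepresenting its preferences while all other agents report truthfully, then the truthful outcome μ satisfies |μ(c)| = q(c), i.e. c fills its capacity under the truthful college-optimal stable matching. -/
variable {S C : Type*} [Fintype S] [Fintype C]

/-- Mutually responsively dominating sets: the dominated one is contained in the dominating one. -/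
theorem RespDominates.subset_of_respDominates {S C : Type*} [Fintype S] [Fintype C]
    {M : Market S C} {c : C} {X Y : Finset S}
    (hXY : RespDominates M c X Y) (hYX : RespDominates M c Y X) : Y ⊆ X := by
  obtain ⟨g, g_inj, g_mem, g_up⟩ := hXY
  obtain ⟨h, h_inj, h_mem, h_up⟩ := hYX
  let := M.cPref c
  have g_le : ∀ s ∈ Y, s ≤ g s := fun s hs =>
    (g_up s hs).elim (fun e => e.ge) (fun l => le_of_lt l)
  have h_le : ∀ s ∈ X, s ≤ h s := fun s hs =>
    (h_up s hs).elim (fun e => e.ge) (fun l => le_of_lt l)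
  have hg_fixed : ∀ s ∈ Y, h (g s) = s := by
    by_contra! hne
    obtain ⟨s, ⟨hsY, hs⟩, hmax⟩ :=
      (Set.toFinite {s | s ∈ Y ∧ h (g s) ≠ s}).exists_maximal hne
    have hmem : h (g s) ∈ Y := h_mem _ (g_mem s hsY)
    have hle : s ≤ h (g s) := (g_le s hsY).trans (h_le _ (g_mem s hsY))
    by_cases hfix : h (g (h (g s))) = h (g s)
    · exact hs (g_inj hmem hsY (h_inj (g_mem _ hmem) (g_mem s hsY) hfix))
    · exact hs (le_antisymm (hmax ⟨hmem, hfix⟩ hle) hle)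
  intro s hs
  have hgs : g s = s := le_antisymm
    ((h_le _ (g_mem s hs)).trans (hg_fixed s hs).le) (g_le s hs)
  exact hgs ▸ g_mem s hs

/-- Responsive domination is antisymmetric. -/
theorem RespDominates.antisymm {S C : Type*} [Fintype S] [Fintype C]
    {M : Market S C} {c : C} {X Y : Finset S}
    (hXY : RespDominates M c X Y) (hYX : RespDominates M c Y X) : X = Y :=
  Finset.Subset.antisymm (hYX.subset_of_respDominates hXY) (hXY.subset_of_respDominates hYX)

/-- Replacing `c`'s list leaves the preferences of the other colleges unchanged. -/
theorem cprefers_replaceCPref_of_ne {S C : Type*} [Fintype S] [Fintype C] [DecidableEq C]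
    (M : Market S C) {c d : C} (P : LinearOrder S) (hdc : d ≠ c) :
    (replaceCPref M c P).cprefers d = M.cprefers d := by
  have h : (replaceCPref M c P).cPref d = M.cPref d := by
    simp only [replaceCPref]
    exact Function.update_of_ne hdc P M.cPref
  unfold Market.cprefers
  rw [h]

/-- A matching that is stable after `c` misreports and leaves `c` a free slot is stable in the
true market. -/
theorem Stable.of_replaceCPref {S C : Type*} [Fintype S] [Fintype C] [DecidableEq C]
    {M : Market S C} {c : C} {P : LinearOrder S} {ν : Matching (replaceCPref M c P)}
    (hν : Stable (replaceCPref M c P) ν) (hfree : (ν.assign c).card < M.q c) :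
    Stable M ⟨ν.assign, ν.card_le, ν.disjoint⟩ := by
  rintro s d ⟨hs, hd⟩
  refine hν s d ⟨hs, ?_⟩
  by_cases hdc : d = c
  · subst hdc
    exact Or.inl hfree
  · rw [cprefers_replaceCPref_of_ne M P hdc]
    exact hd

/-- Summing over the colleges the number of assigned students in `T` counts at most `T`. -/
theorem Matching.sum_card_inter_le {S C : Type*} [Fintype S] [Fintype C] [DecidableEq S]
    {M : Market S C} (μ : Matching M) (T : Finset S) :
    ∑ d, (μ.assign d ∩ T).card ≤ T.card := by
  rw [← Finset.card_biUnion fun d _ e _ hde =>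
    (μ.disjoint d e hde).mono Finset.inter_subset_left Finset.inter_subset_left]
  exact Finset.card_le_card (Finset.biUnion_subset.2 fun _ _ => Finset.inter_subset_right)

/-- If all students in `T` are matched, each of them is counted by some college. -/
theorem Matching.card_le_sum_card_inter {S C : Type*} [Fintype S] [Fintype C] [DecidableEq S]
    {M : Market S C} (μ : Matching M) (T : Finset S) (hT : ∀ s ∈ T, ∃ d, s ∈ μ.assign d) :
    T.card ≤ ∑ d, (μ.assign d ∩ T).card := by
  refine (Finset.card_le_card fun s hs => ?_).trans Finset.card_biUnion_le
  obtain ⟨d, hd⟩ := hT s hs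
  exact Finset.mem_biUnion.2 ⟨d, Finset.mem_univ d, Finset.mem_inter.2 ⟨hd, hs⟩⟩

/-- If `c` has a free slot under a stable matching of the true market, then no stable matching
of the market with `c`'s list replaced assigns more students to `c`. -/
theorem card_assign_le_of_free {S C : Type*} [Fintype S] [Fintype C] [DecidableEq C]
    {M : Market S C} {c : C} {P : LinearOrder S}
    {μ : Matching M} {ν : Matching (replaceCPref M c P)}
    (hμ : Stable M μ) (hν : Stable (replaceCPref M c P) ν)
    (hfree : (μ.assign c).card < M.q c) :
    (ν.assign c).card ≤ (μ.assign c).card := by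
  classical
  have uniq_μ : ∀ {s d e}, s ∈ μ.assign d → s ∈ μ.assign e → d = e := fun {s d e} hd he => by
    by_contra hde
    exact Finset.disjoint_left.1 (μ.disjoint d e hde) hd he
  have uniq_ν : ∀ {s d e}, s ∈ ν.assign d → s ∈ ν.assign e → d = e := fun {s d e} hd he => by
    by_contra hde
    exact Finset.disjoint_left.1 (ν.disjoint d e hde) hd he
  have irrefl : ∀ {s d}, ¬ M.sprefers s d d := fun {s d} =>
    letI := M.sPref s
    lt_irrefl d
  have asymm : ∀ {s d e}, M.sprefers s d e → ¬ M.sprefers s e d := fun {s d e} hde =>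
    letI := M.sPref s
    lt_asymm (show e < d from hde)
  have total : ∀ {s d e}, d ≠ e → ¬ M.sprefers s d e → M.sprefers s e d := fun {s d e} hne hde =>
    letI := M.sPref s
    (lt_or_gt_of_ne hne).resolve_right hde
  have casymm : ∀ {d s t}, M.cprefers d s t → ¬ M.cprefers d t s := fun {d s t} hst =>
    letI := M.cPref d
    lt_asymm (show t < s from hst)
  have ctotal : ∀ {d s t}, s ≠ t → ¬ M.cprefers d s t → M.cprefers d t s :=
    fun {d s t} hne hst =>
      letI := M.cPref d
      (lt_or_gt_of_ne hne).resolve_right hst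
  -- all students are matched under `μ`, to a college weakly preferred to `c`
  have not_c : ∀ {s d}, s ∈ μ.assign d → ¬ M.sprefers s c d := fun {s d} hd hlt =>
    hμ s c ⟨fun e he => uniq_μ hd he ▸ hlt, Or.inl hfree⟩
  have matched : ∀ s, ∃ d, s ∈ μ.assign d := fun s => by
    by_contra! hun
    exact hμ s c ⟨fun e he => absurd he (hun e), Or.inl hfree⟩
  have block_ν : ∀ {s d}, d ≠ c → (∀ e, s ∈ ν.assign e → M.sprefers s d e) →
      ¬ ((ν.assign d).card < M.q d ∨ ∃ t ∈ ν.assign d, M.cprefers d s t) :=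
    fun {s d} hdc hs hd => hν s d ⟨hs, by
      rw [cprefers_replaceCPref_of_ne M P hdc]
      exact hd⟩
  -- the students who strictly prefer `μ`, and those who strictly prefer `ν`
  let A : Finset S := {s | ∃ d, s ∈ μ.assign d ∧ ∀ e, s ∈ ν.assign e → M.sprefers s d e}
  let B : Finset S := {s | ∃ e, s ∈ ν.assign e ∧ ∀ d, s ∈ μ.assign d → M.sprefers s e d}
  have mem_A : ∀ {s d}, s ∈ μ.assign d →
      (s ∈ A ↔ ∀ e, s ∈ ν.assign e → M.sprefers s d e) := fun {s d} hd => by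
    simp only [A, Finset.mem_filter_univ]
    exact ⟨fun ⟨d', hd', h⟩ => uniq_μ hd' hd ▸ h, fun h => ⟨d, hd, h⟩⟩
  have mem_B : ∀ {s e}, s ∈ ν.assign e →
      (s ∈ B ↔ ∀ d, s ∈ μ.assign d → M.sprefers s e d) := fun {s e} he => by
    simp only [B, Finset.mem_filter_univ]
    exact ⟨fun ⟨e', he', h⟩ => uniq_ν he' he ▸ h, fun h => ⟨e, he, h⟩⟩
  have disj_AB : Disjoint A B := Finset.disjoint_left.2 fun s hA hB => by
    simp only [A, B, Finset.mem_filter_univ] at hA hB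
    obtain ⟨d, hd, hdA⟩ := hA
    obtain ⟨e, he, heB⟩ := hB
    exact asymm (hdA e he) (heB d hd)
  have same : ∀ s, s ∉ A → s ∉ B → ∀ d, s ∈ μ.assign d ↔ s ∈ ν.assign d := fun s hA hB => by
    obtain ⟨d, hd⟩ := matched s
    rw [mem_A hd] at hA
    push Not at hA
    obtain ⟨e, he, hde⟩ := hA
    have hed : d = e := by
      by_contra hne
      exact hB ((mem_B he).2 fun d' hd' => uniq_μ hd hd' ▸ total hne hde)
    subst hed
    exact fun d' => ⟨fun h => uniq_μ hd h ▸ he, fun h => uniq_ν he h ▸ hd⟩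
  have indiff : ∀ d, μ.assign d \ (A ∪ B) = ν.assign d \ (A ∪ B) := fun d => by
    ext s
    simp only [Finset.mem_sdiff, Finset.mem_union, not_or]
    exact ⟨fun ⟨h, hA, hB⟩ => ⟨(same s hA hB d).1 h, hA, hB⟩,
      fun ⟨h, hA, hB⟩ => ⟨(same s hA hB d).2 h, hA, hB⟩⟩
  have split : ∀ X : Finset S,
      X.card = (X ∩ A).card + (X ∩ B).card + (X \ (A ∪ B)).card := fun X => by
    rw [← Finset.card_inter_add_card_sdiff X (A ∪ B), Finset.inter_union_distrib_left,
      Finset.card_union_of_disjoint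
        (disj_AB.mono Finset.inter_subset_right Finset.inter_subset_right)]
  -- a college gaining a student from `B` is full under `μ`, one losing a student of `A` under `ν`
  have gain : ∀ {s d}, s ∈ ν.assign d → s ∈ B →
      d ≠ c ∧ s ∉ μ.assign d ∧ (μ.assign d).card = M.q d ∧
        ∀ t ∈ μ.assign d, M.cprefers d t s := fun {s d} hd hB => by
    rw [mem_B hd] at hB
    have hnot : s ∉ μ.assign d := fun h => irrefl (hB d h)
    have hblock : ¬ ((μ.assign d).card < M.q d ∨ ∃ t ∈ μ.assign d, M.cprefers d s t) :=
      fun h => hμ s d ⟨hB, h⟩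
    push Not at hblock
    refine ⟨?_, hnot, le_antisymm (μ.card_le d) hblock.1, fun t ht =>
      ctotal (fun e => hnot (e ▸ ht)) (hblock.2 t ht)⟩
    rintro rfl
    obtain ⟨e, he⟩ := matched s
    exact not_c he (hB e he)
  have lose : ∀ {s d}, d ≠ c → s ∈ μ.assign d → s ∈ A →
      (ν.assign d).card = M.q d ∧ ∀ t ∈ ν.assign d, M.cprefers d t s :=
    fun {s d} hdc hd hA => by
      rw [mem_A hd] at hA
      have hnot : s ∉ ν.assign d := fun h => irrefl (hA d h)
      have hblock := block_ν hdc hA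
      push Not at hblock
      exact ⟨le_antisymm (ν.card_le d) hblock.1, fun t ht =>
        ctotal (fun e => hnot (e ▸ ht)) (hblock.2 t ht)⟩
  have card_B_le : ∀ d, (ν.assign d ∩ B).card ≤ (μ.assign d ∩ B).card := fun d => by
    rcases (ν.assign d ∩ B).eq_empty_or_nonempty with h | ⟨s, hs⟩
    · simp [h]
    obtain ⟨hsd, hsB⟩ := Finset.mem_inter.1 hs
    obtain ⟨hdc, -, hfull, hbetter⟩ := gain hsd hsB
    have hA : μ.assign d ∩ A = ∅ := Finset.eq_empty_of_forall_notMem fun t ht => by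
      obtain ⟨htd, htA⟩ := Finset.mem_inter.1 ht
      exact casymm (hbetter t htd) ((lose hdc htd htA).2 s hsd)
    have h₁ := split (μ.assign d)
    have h₂ := split (ν.assign d)
    have h₃ : (ν.assign d).card ≤ M.q d := ν.card_le d
    rw [hA, Finset.card_empty, indiff d] at h₁
    omega
  have card_A_le : ∀ d, d ≠ c → (μ.assign d ∩ A).card ≤ (ν.assign d ∩ A).card := fun d hdc => by
    rcases (μ.assign d ∩ A).eq_empty_or_nonempty with h | ⟨s, hs⟩
    · simp [h]
    obtain ⟨hsd, hsA⟩ := Finset.mem_inter.1 hs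
    obtain ⟨hfull, hbetter⟩ := lose hdc hsd hsA
    have hB : ν.assign d ∩ B = ∅ := Finset.eq_empty_of_forall_notMem fun t ht => by
      obtain ⟨htd, htB⟩ := Finset.mem_inter.1 ht
      exact casymm (hbetter t htd) ((gain htd htB).2.2.2 s hsd)
    have h₁ := split (μ.assign d)
    have h₂ := split (ν.assign d)
    have h₃ := μ.card_le d
    rw [hB, Finset.card_empty, ← indiff d] at h₂
    omega
  have card_B_c : (ν.assign c ∩ B).card = (μ.assign c ∩ B).card := by
    have hsum : ∑ d, (ν.assign d ∩ B).card = ∑ d, (μ.assign d ∩ B).card :=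
      le_antisymm (Finset.sum_le_sum fun d _ => card_B_le d)
        ((μ.sum_card_inter_le B).trans (ν.card_le_sum_card_inter B fun s hs => by
          obtain ⟨e, he, -⟩ := (Finset.mem_filter_univ s).1 hs
          exact ⟨e, he⟩))
    exact (Finset.sum_eq_sum_iff_of_le fun d _ => card_B_le d).1 hsum c (Finset.mem_univ c)
  have card_A_c : (ν.assign c ∩ A).card ≤ (μ.assign c ∩ A).card := by
    have hsum : ∑ d, (ν.assign d ∩ A).card ≤ ∑ d, (μ.assign d ∩ A).card :=
      (ν.sum_card_inter_le A).trans (μ.card_le_sum_card_inter A fun s _ => matched s)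
    rw [← Finset.add_sum_erase _ _ (Finset.mem_univ c),
      ← Finset.add_sum_erase _ (fun d => (μ.assign d ∩ A).card) (Finset.mem_univ c)] at hsum
    have hrest := Finset.sum_le_sum fun d (hd : d ∈ Finset.univ.erase c) =>
      card_A_le d (Finset.ne_of_mem_erase hd)
    omega
  rw [split (μ.assign c), split (ν.assign c), indiff c]
  omega

/-- If a college `c` can beneficially manipulate the college-optimal
stable mechanism by misreporting (all other agents truthful), then `c` fills its
capacity under the truthful college-optimal stable matching `μ`. -/
theorem stmt_4 {S C : Type*} [Fintype S] [Fintype C] [DecidableEq C]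
    (M : Market S C) (c : C) (P : LinearOrder S)
    (μ : Matching M) (μ' : Matching (replaceCPref M c P))
    (hμ : CollegeOptimal M μ) (hμ' : CollegeOptimal (replaceCPref M c P) μ')
    (hben : StrictRespDominates M c (μ'.assign c) (μ.assign c)) :
    (μ.assign c).card = M.q c := by
  by_contra hne
  have hfree : (μ.assign c).card < M.q c := lt_of_le_of_ne (μ.card_le c) hne
  have hfree' := (card_assign_le_of_free hμ.1 hμ'.1 hfree).trans_lt hfree
  exact hben.1 (hben.2.antisymm (hμ.2 _ (hμ'.1.of_replaceCPref hfree') c))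
end

section
/- A matching μ of a college admissions market (S, C, q, >) is stable if and only if there exists a stable matching ν of the associated one-to-one market such that for every college c, μ(c) = ∪_{c_i ∈ f(c)} ν(c_i), i.e. μ(c) is exactly the set of students matched to copies of c under ν. -/
variable {S C : Type*} [Fintype S] [Fintype C]

theorem assocMarket_sprefers_of_sprefers
    (M : Market S C) {s : S} {c c' : C} (i : Fin (M.q c)) (j : Fin (M.q c'))
    (h : M.sprefers s c c') : (assocMarket M).sprefers s ⟨c, i⟩ ⟨c', j⟩ := by
  let := M.sPref s
  change toLex (c', M.q c' - (j : ℕ)) < toLex (c, M.q c - (i : ℕ))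
  exact Prod.Lex.toLex_lt_toLex.2 (Or.inl h)

theorem sprefers_of_assocMarket_sprefers
    (M : Market S C) {s : S} {c c' : C} {i : Fin (M.q c)} {j : Fin (M.q c')}
    (hne : c' ≠ c) (h : (assocMarket M).sprefers s ⟨c, i⟩ ⟨c', j⟩) : M.sprefers s c c' := by
  let := M.sPref s
  change toLex (c', M.q c' - (j : ℕ)) < toLex (c, M.q c - (i : ℕ)) at h
  exact (Prod.Lex.toLex_lt_toLex.1 h).resolve_right fun h' => hne h'.1

theorem lt_of_assocMarket_sprefers
    (M : Market S C) {s : S} {c : C} {i j : Fin (M.q c)}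
    (h : (assocMarket M).sprefers s ⟨c, i⟩ ⟨c, j⟩) : i < j := by
  let := M.sPref s
  change toLex (c, M.q c - (j : ℕ)) < toLex (c, M.q c - (i : ℕ)) at h
  rcases Prod.Lex.toLex_lt_toLex.1 h with h' | h'
  · exact absurd h' (lt_irrefl c)
  · have h2 : M.q c - (j : ℕ) < M.q c - (i : ℕ) := h'.2
    exact Fin.lt_def.2 (by omega)

open Classical in
/-- The number of students in `X` whom college `c` strictly prefers to `s`. -/
noncomputable def Market.rank (M : Market S C)
    (c : C) (X : Finset S) (s : S) : ℕ :=
  (X.filter fun t => M.cprefers c t s).card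

open Classical in
theorem Market.rank_lt_rank (M : Market S C)
    {c : C} {X : Finset S} {s t : S} (hs : s ∈ X) (h : M.cprefers c s t) :
    M.rank c X s < M.rank c X t := by
  let := M.cPref c
  refine Finset.card_lt_card (Finset.ssubset_iff_of_subset ?_ |>.2 ⟨s, ?_, ?_⟩)
  · intro u hu
    rw [Finset.mem_filter] at hu ⊢
    exact ⟨hu.1, lt_trans (a := t) h hu.2⟩
  · exact Finset.mem_filter.2 ⟨hs, h⟩
  · exact fun hu => lt_irrefl s (Finset.mem_filter.1 hu).2

theorem Market.rank_injOn (M : Market S C)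
    (c : C) (X : Finset S) : Set.InjOn (M.rank c X) X := by
  let := M.cPref c
  intro s hs t ht h
  rcases lt_trichotomy s t with hlt | heq | hlt
  · exact absurd h (M.rank_lt_rank ht hlt).ne'
  · exact heq
  · exact absurd h (M.rank_lt_rank hs hlt).ne

open Classical in
theorem Market.rank_lt_card (M : Market S C)
    {c : C} {X : Finset S} {s : S} (hs : s ∈ X) : M.rank c X s < X.card := by
  let := M.cPref c
  refine Finset.card_lt_card (Finset.filter_ssubset.2 ⟨s, hs, ?_⟩)
  exact lt_irrefl s

theorem Market.exists_rank_eq (M : Market S C)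
    (c : C) {X : Finset S} {i : ℕ} (hi : i < X.card) : ∃ s ∈ X, M.rank c X s = i :=
  Finset.surjOn_of_injOn_of_card_le (t := Finset.range X.card) (M.rank c X)
    (fun _ hs => Finset.mem_coe.2 (Finset.mem_range.2 (M.rank_lt_card hs)))
    (M.rank_injOn c X) (by simp) (Finset.mem_coe.2 (Finset.mem_range.2 hi))

/-- The matching of the associated one-to-one market that gives the `i`-th copy of `c`
the `i`-th best student of `μ.assign c`. -/
noncomputable def Matching.toAssoc {M : Market S C}
    (μ : Matching M) : Matching (assocMarket M) where
  assign x := (μ.assign x.1).filter fun s => M.rank x.1 (μ.assign x.1) s = x.2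
  card_le x := by
    refine Finset.card_le_one.2 fun s hs t ht => ?_
    rw [Finset.mem_filter] at hs ht
    exact M.rank_injOn x.1 _ hs.1 ht.1 (hs.2.trans ht.2.symm)
  disjoint := by
    rintro ⟨c, i⟩ ⟨c', j⟩ hne
    refine Finset.disjoint_left.2 fun s hs ht => ?_
    rw [Finset.mem_filter] at hs ht
    by_cases hc : c = c'
    · subst hc
      exact hne (congrArg (Sigma.mk c) (Fin.ext (hs.2.symm.trans ht.2)))
    · exact Finset.disjoint_left.1 (μ.disjoint c c' hc) hs.1 ht.1

theorem Matching.mem_toAssoc {M : Market S C}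
    {μ : Matching M} {s : S} {c : C} {i : Fin (M.q c)} :
    s ∈ μ.toAssoc.assign ⟨c, i⟩ ↔ s ∈ μ.assign c ∧ M.rank c (μ.assign c) s = i :=
  Finset.mem_filter

theorem Matching.mem_assign_iff_toAssoc
    {M : Market S C} (μ : Matching M) (c : C) (s : S) :
    s ∈ μ.assign c ↔ ∃ i : Fin (M.q c), s ∈ μ.toAssoc.assign ⟨c, i⟩ := by
  refine ⟨fun hs => ?_, fun ⟨i, hi⟩ => (mem_toAssoc.1 hi).1⟩
  exact ⟨⟨_, (M.rank_lt_card hs).trans_le (μ.card_le c)⟩, mem_toAssoc.2 ⟨hs, rfl⟩⟩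

theorem Stable.toAssoc {M : Market S C}
    {μ : Matching M} (h : Stable M μ) : Stable (assocMarket M) μ.toAssoc := by
  rintro s ⟨c, i⟩ ⟨hs, hc⟩
  have hfree : (μ.toAssoc.assign ⟨c, i⟩).card < 1 → (μ.assign c).card ≤ i := by
    intro h0
    by_contra! hi
    obtain ⟨t, ht, hr⟩ := M.exists_rank_eq c hi
    exact absurd (Finset.card_pos.2 ⟨t, Matching.mem_toAssoc.2 ⟨ht, hr⟩⟩) (by omega)
  by_cases hsc : s ∈ μ.assign c
  · obtain ⟨j, hj⟩ := (μ.mem_assign_iff_toAssoc c s).1 hsc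
    have hij : (i : ℕ) < j := lt_of_assocMarket_sprefers M (hs _ hj)
    have hrank := (Matching.mem_toAssoc.1 hj).2
    rcases hc with h0 | ⟨t, ht, hst⟩
    · have := hfree h0
      have := M.rank_lt_card (c := c) hsc
      omega
    · have := M.rank_lt_rank (c := c) hsc hst
      have := (Matching.mem_toAssoc.1 ht).2
      omega
  · refine h s c ⟨fun c' hc' => ?_, ?_⟩
    · obtain ⟨j, hj⟩ := (μ.mem_assign_iff_toAssoc c' s).1 hc'
      exact sprefers_of_assocMarket_sprefers M (fun e => hsc (e ▸ hc')) (hs _ hj)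
    · rcases hc with h0 | ⟨t, ht, hst⟩
      · exact Or.inl ((hfree h0).trans_lt i.isLt)
      · exact Or.inr ⟨t, (Matching.mem_toAssoc.1 ht).1, hst⟩

theorem Stable.of_assoc {M : Market S C}
    {μ : Matching M} {ν : Matching (assocMarket M)} (h : Stable (assocMarket M) ν)
    (hμν : ∀ (c : C) (s : S), s ∈ μ.assign c ↔ ∃ i : Fin (M.q c), s ∈ ν.assign ⟨c, i⟩) :
    Stable M μ := by
  rintro s c ⟨hs, hc⟩
  have hs' (i : Fin (M.q c)) (x : (c : C) × Fin (M.q c)) (hx : s ∈ ν.assign x) :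
      (assocMarket M).sprefers s ⟨c, i⟩ x :=
    assocMarket_sprefers_of_sprefers M i x.2 (hs x.1 ((hμν x.1 s).2 ⟨x.2, hx⟩))
  rcases hc with hcard | ⟨t, ht, hst⟩
  · obtain ⟨i, hi⟩ : ∃ i : Fin (M.q c), ν.assign ⟨c, i⟩ = ∅ := by
      by_contra! hne
      choose f hf using hne
      have hinj : Function.Injective f := by
        intro i j hij
        by_contra hne'
        exact Finset.disjoint_left.1 (ν.disjoint ⟨c, i⟩ ⟨c, j⟩ (by simpa using hne'))
          (hf i) (hij ▸ hf j)
      have hle := Finset.card_le_card_of_injOn (s := Finset.univ) (t := μ.assign c) f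
        (fun i _ => (hμν c _).2 ⟨i, hf i⟩) hinj.injOn
      rw [Finset.card_univ, Fintype.card_fin] at hle
      omega
    refine h s ⟨c, i⟩ ⟨hs' i, Or.inl ?_⟩
    rw [hi]
    exact Nat.one_pos
  · obtain ⟨i, hi⟩ := (hμν c t).1 ht
    exact h s ⟨c, i⟩ ⟨hs' i, Or.inr ⟨t, hi, hst⟩⟩

/-- A matching `μ` of a college admissions market is stable iff there
is a stable matching `ν` of the associated one-to-one market such that for every
college `c`, `μ(c)` is exactly the set of students matched to copies of `c` under `ν`. -/
theorem stmt_7 {S C : Type*} [Fintype S] [Fintype C] (M : Market S C)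
    (μ : Matching M) :
    Stable M μ ↔
      ∃ ν : Matching (assocMarket M), Stable (assocMarket M) ν ∧
        ∀ (c : C) (s : S),
          s ∈ μ.assign c ↔ ∃ i : Fin (M.q c), s ∈ ν.assign ⟨c, i⟩ := by
  exact ⟨fun h => ⟨μ.toAssoc, h.toAssoc, μ.mem_assign_iff_toAssoc⟩,
    fun ⟨_, hν, hμν⟩ => hν.of_assoc hμν⟩
end

section
/- The student-optimal stable mechanism is strategyproof for students: for every student s and every complete strict misreport >' over C, the college assigned to s under the student-optimal stable matching of the profile in which s reports >' (and all other agents report truthfully) is not strictly preferred by s's true order >_s to the college assigned to s under the truthful student-optimal stable matching (where being matched to any college is preferred to being unmatched). -/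
variable {S C : Type*} [Fintype S] [Fintype C]

open Classical in
/-- The students whose favourite college, among those whose cutoff `p` they meet, is `c`.
Utility `0` means unacceptable. -/
noncomputable def demand (u : S → C → ℕ) (r : C → S → ℕ) (p : C → ℕ) (c : C) : Finset S :=
  Finset.univ.filter fun i => 0 < u i c ∧ p c ≤ r c i ∧ ∀ d, p d ≤ r d i → u i d ≤ u i c

/-- The cutoffs `p` induce demands within capacity. -/
def Feasible (q : C → ℕ) (u : S → C → ℕ) (r : C → S → ℕ) (p : C → ℕ) : Prop :=
  ∀ c, (demand u r p c).card ≤ q c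

theorem mem_demand {u : S → C → ℕ} {r : C → S → ℕ} {p : C → ℕ} {c : C} {i : S} :
    i ∈ demand u r p c ↔ 0 < u i c ∧ p c ≤ r c i ∧ ∀ d, p d ≤ r d i → u i d ≤ u i c := by
  simp [demand]

theorem exists_mem_demand {u : S → C → ℕ} {r : C → S → ℕ} {p : C → ℕ} {c : C} {i : S}
    (hu : 0 < u i c) (hp : p c ≤ r c i) : ∃ d, i ∈ demand u r p d ∧ u i c ≤ u i d := by
  classical
  obtain ⟨d, hd, hmax⟩ := Finset.exists_max_image
    (Finset.univ.filter fun d => p d ≤ r d i) (u i) ⟨c, by simpa using hp⟩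
  simp only [Finset.mem_filter, Finset.mem_univ, true_and] at hd hmax
  have hcd := hmax c hp
  exact ⟨d, mem_demand.2 ⟨by omega, hd, hmax⟩, hcd⟩

theorem demand_subset_of_le {u : S → C → ℕ} {r : C → S → ℕ} {p p' : C → ℕ} {c : C}
    (hle : p ≤ p') (hc : p' c ≤ p c) : demand u r p c ⊆ demand u r p' c := by
  intro i hi
  rw [mem_demand] at hi ⊢
  exact ⟨hi.1, hc.trans hi.2.1, fun d hd => hi.2.2 d ((hle d).trans hd)⟩

theorem exists_least_feasible {q : C → ℕ} {u : S → C → ℕ} {r : C → S → ℕ} {p : C → ℕ}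
    (hp : Feasible q u r p) : ∃ p₀, IsLeast {p | Feasible q u r p} p₀ := by
  let A : C → Set ℕ := fun c => {k | ∃ p, Feasible q u r p ∧ p c = k}
  have hle : ∀ p', Feasible q u r p' → (fun c => sInf (A c)) ≤ p' :=
    fun p' hp' c => Nat.sInf_le ⟨p', hp', rfl⟩
  refine ⟨fun c => sInf (A c), fun c => ?_, hle⟩
  obtain ⟨p', hp', hc⟩ : sInf (A c) ∈ A c := Nat.sInf_mem ⟨p c, p, hp, rfl⟩
  exact (Finset.card_le_card (demand_subset_of_le (hle p' hp') hc.le)).trans (hp' c)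

/-- At the least feasible cutoffs, every college with a positive cutoff is full. -/
theorem le_card_demand_of_isLeast {q : C → ℕ} {u : S → C → ℕ} {r : C → S → ℕ} {p : C → ℕ}
    (hr : ∀ c, Function.Injective (r c)) (hp : IsLeast {p | Feasible q u r p} p) {c : C}
    (hc : 0 < p c) : q c ≤ (demand u r p c).card := by
  classical
  by_contra! hlt
  let p' := Function.update p c (p c - 1)
  have hle : p' ≤ p := update_le_iff.2 ⟨Nat.sub_le _ _, fun _ _ => le_rfl⟩
  have hfeas : Feasible q u r p' := by
    intro d
    by_cases hd : d = c
    · subst hd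
      have hsub : demand u r p' d ⊆
          demand u r p d ∪ Finset.univ.filter fun i => r d i = p d - 1 := by
        intro i hi
        rw [mem_demand] at hi
        simp only [Finset.mem_union, Finset.mem_filter, Finset.mem_univ, true_and, mem_demand]
        have hi' : p d - 1 ≤ r d i := by simpa [p'] using hi.2.1
        by_cases h : r d i = p d - 1
        · exact Or.inr h
        · exact Or.inl ⟨hi.1, by omega, fun e he => hi.2.2 e ((hle e).trans he)⟩
      have hone : (Finset.univ.filter fun i => r d i = p d - 1).card ≤ 1 := by
        refine Finset.card_le_one.2 fun i hi j hj => hr d ?_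
        simp only [Finset.mem_filter, Finset.mem_univ, true_and] at hi hj
        omega
      have h1 := Finset.card_le_card hsub
      have h2 := Finset.card_union_le (demand u r p d)
        (Finset.univ.filter fun i => r d i = p d - 1)
      omega
    · exact (Finset.card_le_card (demand_subset_of_le hle (by simp [p', hd]))).trans (hp.1 d)
  have := hp.2 hfeas c
  simp only [p', Function.update_self] at this
  omega

theorem disjoint_demand {u : S → C → ℕ} {r : C → S → ℕ} {p : C → ℕ}
    (hu : ∀ i c d, 0 < u i c → u i c = u i d → c = d) {c d : C} (hcd : c ≠ d) :
    Disjoint (demand u r p c) (demand u r p d) := by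
  refine Finset.disjoint_left.2 fun i hc hd => hcd ?_
  rw [mem_demand] at hc hd
  exact hu i c d hc.1 (le_antisymm (hd.2.2 c hc.2.1) (hc.2.2 d hd.2.1))

/-- Rural hospitals: lowering market-clearing cutoffs to feasible ones matches no new student. -/
theorem exists_mem_demand_of_le {q : C → ℕ} {u : S → C → ℕ} {r : C → S → ℕ} {p p' : C → ℕ}
    (hu : ∀ i c d, 0 < u i c → u i c = u i d → c = d) (hp : Feasible q u r p)
    (hclear : ∀ c, 0 < p' c → q c ≤ (demand u r p' c).card) (hle : p ≤ p')
    {i : S} {c : C} (hi : i ∈ demand u r p c) : ∃ d, i ∈ demand u r p' d := by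
  classical
  have hcard : ∀ d, (demand u r p d).card ≤ (demand u r p' d).card := by
    intro d
    rcases Nat.eq_zero_or_pos (p' d) with h | h
    · exact Finset.card_le_card (demand_subset_of_le hle (by omega))
    · exact (hp d).trans (hclear d h)
  have hsub : Finset.univ.biUnion (demand u r p') ⊆ Finset.univ.biUnion (demand u r p) := by
    intro j hj
    simp only [Finset.mem_biUnion, Finset.mem_univ, true_and] at hj ⊢
    obtain ⟨d, hd⟩ := hj
    rw [mem_demand] at hd
    obtain ⟨e, he, -⟩ := exists_mem_demand (p := p) hd.1 ((hle d).trans hd.2.1)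
    exact ⟨e, he⟩
  have heq := Finset.eq_of_subset_of_card_le hsub (by
    rw [Finset.card_biUnion fun _ _ _ _ h => disjoint_demand hu h,
      Finset.card_biUnion fun _ _ _ _ h => disjoint_demand hu h]
    exact Finset.sum_le_sum fun d _ => hcard d)
  have hmem : i ∈ Finset.univ.biUnion (demand u r p) :=
    Finset.mem_biUnion.2 ⟨c, Finset.mem_univ c, hi⟩
  rw [← heq] at hmem
  simpa using hmem

open Classical in
/-- If `s` can meet the cutoff of `a` at cutoffs that are feasible when `s` accepts only `a`,
then at the least feasible cutoffs he demands a college at least as good as `a`. -/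
theorem exists_mem_demand_of_feasible_single {q : C → ℕ} {u : S → C → ℕ} {r : C → S → ℕ}
    {p p' : C → ℕ} (hu : ∀ i c d, u i c = u i d → c = d) (hpos : ∀ i c, 0 < u i c)
    (hr : ∀ c, Function.Injective (r c)) (hp : IsLeast {p | Feasible q u r p} p) {s : S} {a : C}
    (ha : p' a ≤ r a s)
    (hp' : Feasible q (fun i c => if i = s then if c = a then 1 else 0 else u i c) r p') :
    ∃ b, s ∈ demand u r p b ∧ u s a ≤ u s b := by
  set uN : S → C → ℕ := fun i c => if i = s then if c = a then 1 else 0 else u i c with huN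
  set uT : S → C → ℕ := fun i c => if i = s then if u s a ≤ u s c then u s c else 0 else u i c
    with huT
  have hNs : ∀ c, uN s c = if c = a then 1 else 0 := fun c => if_pos rfl
  have hTs : ∀ c, uT s c = if u s a ≤ u s c then u s c else 0 := fun c => if_pos rfl
  have hN : ∀ i, i ≠ s → uN i = u i := fun i hi => funext fun c => if_neg hi
  have hT : ∀ i, i ≠ s → uT i = u i := fun i hi => funext fun c => if_neg hi
  have hTle : ∀ i c, uT i c ≤ u i c := by
    intro i c
    by_cases hi : i = s
    · subst hi; rw [hTs]; split_ifs <;> omega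
    · rw [hT i hi]
  have hNinj : ∀ i c d, 0 < uN i c → uN i c = uN i d → c = d := by
    intro i c d h0 h
    by_cases hi : i = s
    · subst hi
      rw [hNs] at h0 h
      rw [hNs] at h
      grind
    · rw [hN i hi] at h
      exact hu i c d h
  have hTM : ∀ p c, demand uT r p c ⊆ demand u r p c := by
    intro p c i h
    by_cases hi : i = s
    · subst hi
      rw [mem_demand] at h ⊢
      refine ⟨hpos _ _, h.2.1, fun d hd => ?_⟩
      have h0 := h.1
      have h2 := h.2.2 d hd
      rw [hTs] at h0 h2
      rw [hTs] at h2
      grind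
    · rw [mem_demand] at h ⊢
      rwa [hT i hi] at h
  obtain ⟨pT, hpT⟩ := exists_least_feasible (q := q) (u := uT) (r := r) (p := p)
    fun c => (Finset.card_le_card (hTM p c)).trans (hp.1 c)
  by_cases hmatched : ∃ b, s ∈ demand uT r pT b
  · obtain ⟨b, hb⟩ := hmatched
    have hbM := mem_demand.1 (hTM _ _ hb)
    have hab : u s a ≤ u s b := by
      have := (mem_demand.1 hb).1
      rw [hTs] at this
      grind
    have hfeas : Feasible q u r pT := by
      refine fun c => (Finset.card_le_card fun i h => ?_).trans (hpT.1 c)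
      by_cases hi : i = s
      · subst hi
        have hcb : u i b = u i c :=
          le_antisymm ((mem_demand.1 h).2.2 b hbM.2.1) (hbM.2.2 c (mem_demand.1 h).2.1)
        rwa [← hu i b c hcb]
      · rw [mem_demand] at h ⊢
        rwa [hT i hi]
    obtain ⟨d, hd, hbd⟩ := exists_mem_demand (hpos s b) ((hp.2 hfeas b).trans hbM.2.1)
    exact ⟨d, hd, hab.trans hbd⟩
  · exfalso
    have hNT : ∀ c, demand uN r pT c = demand uT r pT c := by
      intro c
      ext i
      by_cases hi : i = s
      · subst hi
        refine ⟨fun h => ?_, fun h => (hmatched ⟨c, h⟩).elim⟩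
        rw [mem_demand] at h
        have hca : c = a := by
          have := h.1
          rw [hNs] at this
          grind
        obtain ⟨d, hd, -⟩ := exists_mem_demand (u := uT) (p := pT) (r := r) (i := i) (c := a)
          (by rw [hTs, if_pos le_rfl]; exact hpos _ _) (hca ▸ h.2.1)
        exact (hmatched ⟨d, hd⟩).elim
      · rw [mem_demand, mem_demand, hT i hi, hN i hi]
    obtain ⟨pN, hpN⟩ := exists_least_feasible hp'
    obtain ⟨d, hd, -⟩ := exists_mem_demand (u := uN) (p := pN) (r := r) (i := s) (c := a)
      (by rw [hNs, if_pos rfl]; exact one_pos) ((hpN.2 hp' a).trans ha)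
    obtain ⟨e, he⟩ := exists_mem_demand_of_le hNinj hpN.1 (p' := pT)
      (fun c hc => by rw [hNT]; exact le_card_demand_of_isLeast hr hpT hc)
      (hpN.2 fun c => by rw [hNT]; exact hpT.1 c) hd
    exact hmatched ⟨e, hNT e ▸ he⟩

open Classical in
/-- The number of elements weakly below `a`. -/
noncomputable def orderRank {α : Type*} [Fintype α] (L : LinearOrder α) (a : α) : ℕ :=
  (Finset.univ.filter fun b => L.le b a).card

theorem orderRank_lt_iff {α : Type*} [Fintype α] (L : LinearOrder α) {a b : α} :
    orderRank L a < orderRank L b ↔ L.lt a b := by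
  classical
  have hmono : ∀ {a b : α}, a ≤ b → orderRank L a ≤ orderRank L b := fun h =>
    Finset.card_le_card fun x hx => by
      simp only [Finset.mem_filter, Finset.mem_univ, true_and] at hx ⊢
      exact le_trans hx h
  refine ⟨fun h => lt_of_not_ge fun h' => absurd (hmono h') (not_le.2 h), fun h => ?_⟩
  change a < b at h
  refine Finset.card_lt_card (Finset.ssubset_iff_of_subset ?_ |>.2 ⟨b, ?_, ?_⟩)
  · intro x hx
    simp only [Finset.mem_filter, Finset.mem_univ, true_and] at hx ⊢
    exact le_trans hx h.le
  · simp
  · simpa using h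

theorem orderRank_injective {α : Type*} [Fintype α] (L : LinearOrder α) :
    Function.Injective (orderRank L) := by
  intro a b h
  rcases lt_trichotomy a b with h' | h' | h'
  · exact absurd h ((orderRank_lt_iff L).2 h').ne
  · exact h'
  · exact absurd h.symm ((orderRank_lt_iff L).2 h').ne

theorem orderRank_pos {α : Type*} [Fintype α] (L : LinearOrder α) (a : α) :
    0 < orderRank L a :=
  Finset.card_pos.2 ⟨a, by simp⟩

/-- The utility of college `c` for student `i`. -/
noncomputable def Market.utility (M : Market S C) (i : S) (c : C) : ℕ := orderRank (M.sPref i) c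

/-- The score of student `i` at college `c`. -/
noncomputable def Market.score (M : Market S C) (c : C) (i : S) : ℕ := orderRank (M.cPref c) i

theorem Market.utility_lt_iff (M : Market S C) {i : S} {c d : C} :
    M.utility i c < M.utility i d ↔ M.sprefers i d c :=
  orderRank_lt_iff _

theorem Market.score_lt_iff (M : Market S C) {c : C} {i j : S} :
    M.score c i < M.score c j ↔ M.cprefers c j i :=
  orderRank_lt_iff _

theorem Market.utility_injective (M : Market S C) (i : S) : Function.Injective (M.utility i) :=
  orderRank_injective _

theorem Market.score_injective (M : Market S C) (c : C) : Function.Injective (M.score c) :=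
  orderRank_injective _

theorem Market.utility_pos (M : Market S C) (i : S) (c : C) : 0 < M.utility i c :=
  orderRank_pos _ _

/-- Every matching has cutoffs met by its assigned students such that each college whose cutoff
is met by a student not assigned to it has a free slot or prefers him to one of its students. -/
theorem exists_cutoff (M : Market S C) (μ : Matching M) :
    ∃ p : C → ℕ, (∀ c, ∀ i ∈ μ.assign c, p c ≤ M.score c i) ∧
      ∀ c i, i ∉ μ.assign c → p c ≤ M.score c i →
        (μ.assign c).card < M.q c ∨ ∃ j ∈ μ.assign c, M.cprefers c i j := by
  refine ⟨fun c => if (μ.assign c).card < M.q c then 0 else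
    sInf (Set.image (M.score c) (μ.assign c)), fun c i hi => ?_, fun c i hi h => ?_⟩
  · dsimp only
    split_ifs
    · exact Nat.zero_le _
    · exact Nat.sInf_le ⟨i, hi, rfl⟩
  · by_cases hcard : (μ.assign c).card < M.q c
    · exact Or.inl hcard
    · right
      have hne : (μ.assign c).Nonempty := Finset.card_pos.1 (by have := M.q_pos c; omega)
      simp only [if_neg hcard] at h
      obtain ⟨j, hj, hjr⟩ := Nat.sInf_mem ((Finset.coe_nonempty.2 hne).image
        (M.score c))
      refine ⟨j, hj, M.score_lt_iff.1 (lt_of_le_of_ne (hjr.trans_le h) fun he => hi ?_)⟩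
      exact M.score_injective c he ▸ hj

/-- A student not blocking with `c` is assigned to `c` if he demands it at supporting cutoffs. -/
theorem mem_assign_of_best {M : Market S C} {μ : Matching M} (hμ : Stable M μ) {p : C → ℕ}
    (hp : ∀ c, ∀ i ∈ μ.assign c, p c ≤ M.score c i)
    (hp' : ∀ c i, i ∉ μ.assign c → p c ≤ M.score c i →
      (μ.assign c).card < M.q c ∨ ∃ j ∈ μ.assign c, M.cprefers c i j)
    {i : S} {c : C} (hc : p c ≤ M.score c i)
    (hbest : ∀ d, p d ≤ M.score d i → M.utility i d ≤ M.utility i c) : i ∈ μ.assign c := by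
  by_contra hi
  refine hμ i c ⟨fun d hd => M.utility_lt_iff.1 (lt_of_le_of_ne (hbest d (hp d i hd))
    fun he => hi ?_), hp' c i hi hc⟩
  exact M.utility_injective i he ▸ hd

theorem exists_feasible_of_stable {M : Market S C} {μ : Matching M} (hμ : Stable M μ) :
    ∃ p, Feasible M.q M.utility M.score p := by
  obtain ⟨p, hp, hp'⟩ := exists_cutoff M μ
  refine ⟨p, fun c => (Finset.card_le_card fun i hi => ?_).trans (μ.card_le c)⟩
  rw [mem_demand] at hi
  exact mem_assign_of_best hμ hp hp' hi.2.1 hi.2.2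

/-- The least feasible cutoffs induce a stable matching. -/
theorem exists_stable_of_isLeast {M : Market S C} {p : C → ℕ}
    (hp : IsLeast {p | Feasible M.q M.utility M.score p} p) :
    ∃ ν : Matching M, Stable M ν ∧ ν.assign = demand M.utility M.score p := by
  refine ⟨⟨demand M.utility M.score p, hp.1, fun c d h =>
    disjoint_demand (fun i c d _ h => M.utility_injective i h) h⟩, ?_, rfl⟩
  rintro i c ⟨hs, hc⟩
  dsimp only at hs hc
  by_cases h : p c ≤ M.score c i
  · obtain ⟨d, hd, hcd⟩ := exists_mem_demand (M.utility_pos i c) h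
    exact absurd (M.utility_lt_iff.2 (hs d hd)) (not_lt.2 hcd)
  · have hfull := le_card_demand_of_isLeast M.score_injective hp
      (c := c) (by omega)
    obtain ⟨j, hj, hij⟩ := hc.resolve_left (by omega)
    have h1 : M.score c j < M.score c i := M.score_lt_iff.2 hij
    have h2 := (mem_demand.1 hj).2.1
    omega

/-- The student-optimal stable mechanism is strategyproof for
students: no student `s` can, by misreporting a complete strict list `P` over the
colleges while everyone else is truthful, obtain a college strictly preferred (w.r.t.
his true order) to his truthful assignment (being matched beats being unmatched). -/
theorem stmt_12 {S C : Type*} [Fintype S] [Fintype C] [DecidableEq S]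
    (M : Market S C) (s : S) (P : LinearOrder C)
    (μ : Matching M) (μ' : Matching (replaceSPref M s P))
    (hμ : StudentOptimal M μ) (hμ' : StudentOptimal (replaceSPref M s P) μ') :
    ¬ ∃ c', s ∈ μ'.assign c' ∧
        ((∀ c, s ∉ μ.assign c) ∨ ∃ c, s ∈ μ.assign c ∧ M.sprefers s c' c) := by
  classical
  rintro ⟨a, ha, hpref⟩
  obtain ⟨p₀, hp₀⟩ := exists_feasible_of_stable hμ.1
  obtain ⟨p, hp⟩ := exists_least_feasible hp₀
  obtain ⟨p', hp', hp''⟩ := exists_cutoff _ μ'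
  obtain ⟨b, hb, hab⟩ := exists_mem_demand_of_feasible_single (s := s) (a := a) (p' := p')
    (fun i c d h => M.utility_injective i h) M.utility_pos M.score_injective hp (hp' a s ha) (by
      refine fun c => (Finset.card_le_card fun i hi => ?_).trans (μ'.card_le c)
      rw [mem_demand] at hi
      by_cases his : i = s
      · subst his
        obtain rfl : c = a := by
          have := hi.1
          grind
        exact ha
      · simp only [if_neg his] at hi
        refine mem_assign_of_best hμ'.1 hp' hp'' hi.2.1 ?_
        have hu : (replaceSPref M s P).utility i = M.utility i := by
          funext d
          simp [Market.utility, replaceSPref, Function.update_of_ne his]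
        rw [hu]
        exact hi.2.2)
  obtain ⟨ν, hν, hνp⟩ := exists_stable_of_isLeast hp
  rw [← hνp] at hb
  have huniq : ∀ (ρ : Matching M) {c d : C}, s ∈ ρ.assign c → s ∈ ρ.assign d → c = d :=
    fun ρ c d hc hd => by_contra fun h => Finset.disjoint_left.1 (ρ.disjoint c d h) hc hd
  obtain ⟨e, he, hbe⟩ : ∃ e, s ∈ μ.assign e ∧ M.utility s b ≤ M.utility s e := by
    rcases hμ.2 ν hν s with h | ⟨e, he, h | ⟨d, hd, hed⟩⟩
    · exact ⟨b, (h b).2 hb, le_rfl⟩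
    · exact absurd hb (h b)
    · exact ⟨e, he, huniq ν hd hb ▸ (M.utility_lt_iff.2 hed).le⟩
  rcases hpref with h | ⟨c, hc, hlt⟩
  · exact h e he
  · have h1 : M.utility s c < M.utility s a := M.utility_lt_iff.2 hlt
    rw [huniq μ hc he] at h1
    omega
end
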